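/- Let M be a Lasserre₂-feasible matrix on n qubits, and let C be a cycle of odd length m ≥ 3 on distinct qubits c₀, c₁, …, c_{m−1} (with edges c₀c₁, c₁c₂, …, c_{m−1}c₀). Then Σ_{edges pq of C} v_pq ≥ 2 − m. -/

import Mathlib

open Matrix

/-- The 2×2 Pauli matrices `I, X, Y, Z`, indexed by `Fin 4` (with `0 ↦ I`). -/
noncomputable def pauli : Fin 4 → Matrix (Fin 2) (Fin 2) ℂ
  | 0 => 1
  | 1 => !![0, 1; 1, 0]
  | 2 => !![0, -Complex.I; Complex.I, 0]
  | 3 => !![1, 0; 0, -1]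

/-- A Pauli word on `n` qubits: a choice of `I, X, Y` or `Z` for each qubit. -/
abbrev PauliWord (n : ℕ) := Fin n → Fin 4

/-- The matrix of a Pauli word: the `n`-fold Kronecker product of its letters, realized
on `ℂ^{2^n}` identified with functions `Fin n → Fin 2`, so the entries are products of
entries of the 2×2 factors. -/
noncomputable def wordMat {n : ℕ} (w : PauliWord n) :
    Matrix (Fin n → Fin 2) (Fin n → Fin 2) ℂ :=
  Matrix.of fun f g => ∏ k, pauli (w k) (f k) (g k)

/-- The weight of a Pauli word: the number of non-identity letters. -/
def wordWeight {n : ℕ} (w : PauliWord n) : ℕ :=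
  (Finset.univ.filter fun k => w k ≠ 0).card

/-- `P_n(2)`: Pauli words on `n` qubits with at most 2 non-identity factors. -/
abbrev PauliWord2 (n : ℕ) := {w : PauliWord n // wordWeight w ≤ 2}

/-- The all-identity Pauli word, as an element of `P_n(2)`. -/
def idWord (n : ℕ) : PauliWord2 n := ⟨fun _ => 0, by simp [wordWeight]⟩

/-- The Pauli word `σ_i σ_j` with letter `σ` at positions `i` and `j` and identity
elsewhere, as an element of `P_n(2)`. -/
def pairWord {n : ℕ} (σ : Fin 4) (i j : Fin n) : PauliWord2 n :=
  ⟨fun k => if k = i ∨ k = j then σ else 0, by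
    classical
    unfold wordWeight
    have hsub : (Finset.univ.filter fun k =>
        (if k = i ∨ k = j then σ else (0 : Fin 4)) ≠ 0) ⊆ ({i, j} : Finset (Fin n)) := by
      intro k hk
      simp only [Finset.mem_filter, Finset.mem_univ, true_and] at hk
      simp only [Finset.mem_insert, Finset.mem_singleton]
      by_contra h
      push_neg at h
      exact hk (if_neg (by tauto))
    exact le_trans (Finset.card_le_card hsub)
      (by simpa using Finset.card_insert_le i ({j} : Finset (Fin n)))⟩

/-- A real symmetric matrix `M` with rows and columns indexed by `P_n(2)` is
Lasserre₂-feasible if it is positive semidefinite, has unit diagonal, vanishes at pairs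
whose Pauli product is not Hermitian, and respects equality (resp. negation) of Pauli
products. -/
def Lasserre2Feasible {n : ℕ} (M : Matrix (PauliWord2 n) (PauliWord2 n) ℝ) : Prop :=
  M.IsSymm ∧ M.PosSemidef ∧
  (∀ Γ, M Γ Γ = 1) ∧
  (∀ Γ Φ : PauliWord2 n, ¬(wordMat Γ.1 * wordMat Φ.1).IsHermitian → M Γ Φ = 0) ∧
  (∀ Γ Φ Γ' Φ' : PauliWord2 n,
    wordMat Γ.1 * wordMat Φ.1 = wordMat Γ'.1 * wordMat Φ'.1 → M Γ Φ = M Γ' Φ') ∧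
  (∀ Γ Φ Γ' Φ' : PauliWord2 n,
    wordMat Γ.1 * wordMat Φ.1 = -(wordMat Γ'.1 * wordMat Φ'.1) → M Γ Φ = -M Γ' Φ')

/-- The edge value `v_ij` from a Lasserre₂ moment matrix. -/
noncomputable def edgeVal {n : ℕ} (M : Matrix (PauliWord2 n) (PauliWord2 n) ℝ)
    (i j : Fin n) : ℝ :=
  (M (pairWord 1 i j) (idWord n) + M (pairWord 2 i j) (idWord n)
    + M (pairWord 3 i j) (idWord n)) / 3

lemma pauli_mul_self (σ : Fin 4) : pauli σ * pauli σ = 1 := by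
  fin_cases σ <;> ext a b <;> fin_cases a <;> fin_cases b <;>
    simp [pauli, Matrix.mul_apply, Fin.sum_univ_two]

lemma wordMat_mul_apply {n : ℕ} (w w' : PauliWord n) (f g : Fin n → Fin 2) :
    (wordMat w * wordMat w') f g = ∏ k, (pauli (w k) * pauli (w' k)) (f k) (g k) := by
  simp only [Matrix.mul_apply, wordMat, Matrix.of_apply, ← Finset.prod_mul_distrib]
  rw [Finset.prod_univ_sum, Fintype.piFinset_univ]

/-- A product of two Pauli words is determined by the products of their letters. -/
lemma wordMat_mul_congr {n : ℕ} {w₁ w₂ w₃ w₄ : PauliWord n}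
    (h : ∀ k, pauli (w₁ k) * pauli (w₂ k) = pauli (w₃ k) * pauli (w₄ k)) :
    wordMat w₁ * wordMat w₂ = wordMat w₃ * wordMat w₄ := by
  ext f g
  simp only [wordMat_mul_apply, h]

lemma pairWord_comm {n : ℕ} (σ : Fin 4) (i j : Fin n) : pairWord σ i j = pairWord σ j i := by
  simp only [pairWord, or_comm]

/-- The relation `(σ_i σ_j)(σ_j σ_k) = σ_i σ_k` for distinct `i, j, k`. -/
lemma wordMat_pairWord_mul {n : ℕ} (σ : Fin 4) {i j k : Fin n}
    (hij : i ≠ j) (hjk : j ≠ k) (hik : i ≠ k) :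
    wordMat (pairWord σ i j).1 * wordMat (pairWord σ j k).1 =
      wordMat (pairWord σ i k).1 * wordMat (idWord n).1 := by
  refine wordMat_mul_congr fun l => ?_
  have h0 : pauli 0 = 1 := rfl
  by_cases hi : l = i
  · subst hi
    simp [pairWord, idWord, hij, hik]
  · by_cases hj : l = j
    · subst hj
      simp [pairWord, idWord, hi, hjk, h0, pauli_mul_self]
    · simp [pairWord, idWord, hi, hj, h0]

section Feasible

variable {n : ℕ} {M : Matrix (PauliWord2 n) (PauliWord2 n) ℝ}

lemma Lasserre2Feasible.apply_pairWord_pairWord (hM : Lasserre2Feasible M) (σ : Fin 4)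
    {i j k : Fin n} (hij : i ≠ j) (hjk : j ≠ k) (hik : i ≠ k) :
    M (pairWord σ i j) (pairWord σ j k) = M (pairWord σ i k) (idWord n) :=
  hM.2.2.2.2.1 _ _ _ _ (wordMat_pairWord_mul σ hij hjk hik)

/-- The triangle inequalities, for signs `a, b` on the edges `ij, jk` and `a * b` on `ik`. -/
lemma Lasserre2Feasible.triangle (hM : Lasserre2Feasible M) (σ : Fin 4)
    {i j k : Fin n} (hij : i ≠ j) (hjk : j ≠ k) (hik : i ≠ k)
    {a b : ℝ} (ha : a * a = 1) (hb : b * b = 1) :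
    -1 ≤ a * M (pairWord σ i j) (idWord n) + b * M (pairWord σ j k) (idWord n)
      + a * b * M (pairWord σ i k) (idWord n) := by
  have hsymm : ∀ Γ Φ, M Γ Φ = M Φ Γ := fun Γ Φ => hM.1.apply Φ Γ
  have h₁ := hM.apply_pairWord_pairWord σ hij hjk hik
  have h₂ := hM.apply_pairWord_pairWord σ hij.symm hik hjk
  have h₃ := hM.apply_pairWord_pairWord σ hik hjk.symm hij
  rw [pairWord_comm σ j i] at h₂
  rw [pairWord_comm σ k j] at h₃
  have hnonneg := (hM.2.1.submatrix ![idWord n, pairWord σ i j, pairWord σ j k,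
    pairWord σ i k]).dotProduct_mulVec_nonneg ![1, a, b, a * b]
  simp only [dotProduct, mulVec, Fin.sum_univ_four, Matrix.submatrix_apply, Pi.star_apply,
    star_trivial, Matrix.cons_val] at hnonneg
  rw [hsymm (idWord n) (pairWord σ i j), hsymm (idWord n) (pairWord σ j k),
    hsymm (idWord n) (pairWord σ i k), hsymm (pairWord σ j k) (pairWord σ i j),
    hsymm (pairWord σ i k) (pairWord σ i j), hsymm (pairWord σ j k) (pairWord σ i k),
    h₁, h₂, h₃] at hnonneg
  simp only [hM.2.2.1] at hnonneg
  have hab : (a * b) * (a * b) = 1 := by linear_combination (b * b) * ha + hb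
  generalize M (pairWord σ i j) (idWord n) = x at *
  generalize M (pairWord σ j k) (idWord n) = y at *
  generalize M (pairWord σ i k) (idWord n) = z at *
  linear_combination (1 / 4) * hnonneg
    + (1 / 4 + b * y / 2) * ha + (1 / 4 + a * x / 2) * hb + (1 / 4) * hab

/-- The odd-cycle inequality for the path `u 0, …, u (2 * t + 2)` closed by the edge between its
ends. -/
lemma Lasserre2Feasible.odd_path (hM : Lasserre2Feasible M) (σ : Fin 4) (u : ℕ → Fin n)
    (t : ℕ) (hu : Set.InjOn u (Set.Iic (2 * t + 2))) :
    -(2 * t + 1 : ℝ) ≤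
      ∑ k ∈ Finset.range (2 * t + 2), M (pairWord σ (u k) (u (k + 1))) (idWord n)
        + M (pairWord σ (u 0) (u (2 * t + 2))) (idWord n) := by
  have hne : ∀ p q, p ≤ 2 * t + 2 → q ≤ 2 * t + 2 → p ≠ q → u p ≠ u q :=
    fun p q hp hq hpq h => hpq (hu hp hq h)
  induction t with
  | zero =>
    have h := hM.triangle σ (hne 0 1 (by omega) (by omega) (by omega))
      (hne 1 2 (by omega) (by omega) (by omega)) (hne 0 2 (by omega) (by omega) (by omega))
      (a := 1) (b := 1) (by norm_num) (by norm_num)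
    simp only [Finset.sum_range_succ, Finset.sum_range_zero, mul_zero, zero_add, one_mul,
      Nat.cast_zero] at h ⊢
    linarith
  | succ t ih =>
    have hprev := ih (hu.mono (Set.Iic_subset_Iic.2 (by omega)))
      fun p q hp hq => hne p q (by omega) (by omega)
    have h₁ := hM.triangle σ (hne 0 (2 * t + 2) (by omega) (by omega) (by omega))
      (hne (2 * t + 2) (2 * t + 3) (by omega) (by omega) (by omega))
      (hne 0 (2 * t + 3) (by omega) (by omega) (by omega))
      (a := -1) (b := 1) (by norm_num) (by norm_num)
    have h₂ := hM.triangle σ (hne 0 (2 * t + 3) (by omega) (by omega) (by omega))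
      (hne (2 * t + 3) (2 * t + 4) (by omega) (by omega) (by omega))
      (hne 0 (2 * t + 4) (by omega) (by omega) (by omega))
      (a := 1) (b := 1) (by norm_num) (by norm_num)
    rw [show 2 * (t + 1) + 2 = 2 * t + 2 + 1 + 1 by ring, Finset.sum_range_succ,
      Finset.sum_range_succ]
    push_cast
    linarith

lemma Lasserre2Feasible.odd_cycle_letter (hM : Lasserre2Feasible M) (σ : Fin 4) (m : ℕ)
    [NeZero m] (hm3 : 3 ≤ m) (hmodd : Odd m) (c : Fin m → Fin n)
    (hc : Function.Injective c) :
    2 - (m : ℝ) ≤ ∑ i : Fin m, M (pairWord σ (c i) (c (i + 1))) (idWord n) := by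
  obtain ⟨t, rfl⟩ : ∃ t, m = 2 * t + 3 := by
    obtain ⟨s, rfl⟩ := hmodd
    exact ⟨s - 1, by omega⟩
  have hu : Set.InjOn (fun k => c (Fin.ofNat (2 * t + 3) k)) (Set.Iic (2 * t + 2)) := by
    intro p hp q hq hpq
    simp only [Set.mem_Iic] at hp hq
    have h := congrArg Fin.val (hc hpq)
    simpa [Fin.ofNat, Nat.mod_eq_of_lt (show p < 2 * t + 3 by omega),
      Nat.mod_eq_of_lt (show q < 2 * t + 3 by omega)] using h
  have hpath := hM.odd_path σ _ t hu
  have hsum : ∑ i : Fin (2 * t + 3), M (pairWord σ (c i) (c (i + 1))) (idWord n) =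
      ∑ k ∈ Finset.range (2 * t + 3), M (pairWord σ (c (Fin.ofNat (2 * t + 3) k))
        (c (Fin.ofNat (2 * t + 3) (k + 1)))) (idWord n) := by
    rw [← Fin.sum_univ_eq_sum_range (fun k => M (pairWord σ (c (Fin.ofNat (2 * t + 3) k))
        (c (Fin.ofNat (2 * t + 3) (k + 1)))) (idWord n))]
    refine Finset.sum_congr rfl fun i _ => ?_
    have h₁ : Fin.ofNat (2 * t + 3) i = i := Fin.ext (Nat.mod_eq_of_lt i.2)
    have h₂ : Fin.ofNat (2 * t + 3) (i + 1) = i + 1 := by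
      ext
      simp [Fin.ofNat, Fin.val_add]
    rw [h₁, h₂]
  have hlast : Fin.ofNat (2 * t + 3) (2 * t + 2 + 1) = Fin.ofNat (2 * t + 3) 0 := by
    ext
    simp [Fin.ofNat]
  rw [hsum, Finset.sum_range_succ, hlast, pairWord_comm σ (c (Fin.ofNat _ (2 * t + 2)))]
  push_cast
  linarith

end Feasible

/-- Odd-cycle inequality for Lasserre₂ edge values: if `M` is Lasserre₂-feasible on `n`
qubits and `c 0, c 1, …, c (m-1)` are the distinct vertices of a cycle of odd length
`m ≥ 3` (with edges `c i — c (i+1)`, indices mod `m`), then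
`Σ_{edges pq of the cycle} v_pq ≥ 2 − m`. -/
theorem lasserre2_odd_cycle {n : ℕ} (M : Matrix (PauliWord2 n) (PauliWord2 n) ℝ)
    (hM : Lasserre2Feasible M) (m : ℕ) [NeZero m] (hm3 : 3 ≤ m) (hmodd : Odd m)
    (c : Fin m → Fin n) (hc : Function.Injective c) :
    ∑ i : Fin m, edgeVal M (c i) (c (i + 1)) ≥ 2 - (m : ℝ) := by
  have h₁ := hM.odd_cycle_letter 1 m hm3 hmodd c hc
  have h₂ := hM.odd_cycle_letter 2 m hm3 hmodd c hc
  have h₃ := hM.odd_cycle_letter 3 m hm3 hmodd c hc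
  simp only [edgeVal, ← Finset.sum_div, Finset.sum_add_distrib]
  linarith
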